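/- For any finite set X of terminals in the Euclidean plane and positive integer k, there exists a k-bottleneck Steiner minimum tree T on X (with Steiner point set S, |S| ≤ k) such that T is a minimum spanning tree on X ∪ S and every vertex of T has degree at most 5. -/

import Mathlib

noncomputable section
abbrev Pt := EuclideanSpace ℝ (Fin 2)

instance : DecidableEq Pt := Classical.decEq _

/-- Length of an edge (pair of vertices drawn from the finite point set `Y`). -/
def elen (Y : Finset Pt) : Sym2 ↥Y → ℝ :=
  Sym2.lift ⟨fun a b => dist (a : Pt) (b : Pt), fun _ _ => dist_comm _ _⟩

/-- Bottleneck (longest edge length) of a graph on the points `Y`. -/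
def bneck (Y : Finset Pt) (G : SimpleGraph ↥Y) : ℝ :=
  ⨆ e ∈ G.edgeSet, elen Y e

/-- Total edge length of a graph on the points `Y`. -/
def totalLen (Y : Finset Pt) (G : SimpleGraph ↥Y) : ℝ :=
  ∑ e ∈ (Set.toFinite G.edgeSet).toFinset, elen Y e

lemma law_cos_arg (z w : ℂ) :
    ‖z - w‖ ^ 2 = ‖z‖ ^ 2 + ‖w‖ ^ 2 - 2 * ‖z‖ * ‖w‖ * Real.cos (z.arg - w.arg) := by
  have h1 := Complex.norm_mul_cos_arg z
  have h2 := Complex.norm_mul_sin_arg z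
  have h3 := Complex.norm_mul_cos_arg w
  have h4 := Complex.norm_mul_sin_arg w
  have e1 : ‖z - w‖ ^ 2 = (z.re - w.re) ^ 2 + (z.im - w.im) ^ 2 := by
    rw [Complex.sq_norm, Complex.normSq_apply]; simp; ring
  have e2 : ‖z‖ ^ 2 = z.re ^ 2 + z.im ^ 2 := by
    rw [Complex.sq_norm, Complex.normSq_apply]; ring
  have e3 : ‖w‖ ^ 2 = w.re ^ 2 + w.im ^ 2 := by
    rw [Complex.sq_norm, Complex.normSq_apply]; ring
  rw [Real.cos_sub]
  have e4 : 2 * ‖z‖ * ‖w‖ * (Real.cos z.arg * Real.cos w.arg + Real.sin z.arg * Real.sin w.arg)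
      = 2 * (‖z‖ * Real.cos z.arg) * (‖w‖ * Real.cos w.arg)
        + 2 * (‖z‖ * Real.sin z.arg) * (‖w‖ * Real.sin w.arg) := by ring
  rw [e4, h1, h2, h3, h4, e1, e2, e3]; ring

/-- Two nonzero vectors at angle at most `π/3`: the opposite side is at most one of the others,
and in case of equality with the longest the triangle is equilateral. -/
lemma angle_le_aux (z w : ℂ) (hz : z ≠ 0) (hw : w ≠ 0)
    (h1 : ‖z‖ ≤ ‖z - w‖) (h2 : ‖w‖ < ‖z - w‖)
    (hc : |z.arg - w.arg| ≤ Real.pi / 3) : False := by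
  have hcos : (1 : ℝ) / 2 ≤ Real.cos (z.arg - w.arg) := by
    rw [← Real.cos_abs, ← Real.cos_pi_div_three]
    exact Real.cos_le_cos_of_nonneg_of_le_pi (abs_nonneg _) (by linarith [Real.pi_pos]) hc
  have hl := law_cos_arg z w
  have pz : 0 < ‖z‖ := norm_pos_iff.2 hz
  have pw : 0 < ‖w‖ := norm_pos_iff.2 hw
  have hp : 0 < ‖z‖ * ‖w‖ := by positivity
  have k1 : ‖z - w‖ ^ 2 ≤ ‖z‖ ^ 2 + ‖w‖ ^ 2 - ‖z‖ * ‖w‖ := by nlinarith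
  have k2 : ‖z‖ ^ 2 ≤ ‖z - w‖ ^ 2 := by gcongr
  have k3 : ‖w‖ ^ 2 < ‖z - w‖ ^ 2 := by gcongr
  rcases le_total ‖w‖ ‖z‖ with h | h
  · rcases h.lt_or_eq with h | h
    · nlinarith
    · rw [h] at k1 k3; nlinarith
  · nlinarith

lemma angle_lt_aux (z w : ℂ) (hz : z ≠ 0) (hw : w ≠ 0)
    (h1 : ‖z‖ ≤ ‖z - w‖) (h2 : ‖w‖ ≤ ‖z - w‖)
    (hc : |z.arg - w.arg| < Real.pi / 3) : False := by
  have hcos : (1 : ℝ) / 2 < Real.cos (z.arg - w.arg) := by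
    rw [← Real.cos_abs, ← Real.cos_pi_div_three]
    exact Real.cos_lt_cos_of_nonneg_of_le_pi (abs_nonneg _) (by linarith [Real.pi_pos]) hc
  have hl := law_cos_arg z w
  have pz : 0 < ‖z‖ := norm_pos_iff.2 hz
  have pw : 0 < ‖w‖ := norm_pos_iff.2 hw
  have hp : 0 < ‖z‖ * ‖w‖ := by positivity
  have k1 : ‖z - w‖ ^ 2 < ‖z‖ ^ 2 + ‖w‖ ^ 2 - ‖z‖ * ‖w‖ := by nlinarith
  have k2 : ‖z‖ ^ 2 ≤ ‖z - w‖ ^ 2 := by gcongr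
  have k3 : ‖w‖ ^ 2 ≤ ‖z - w‖ ^ 2 := by gcongr
  rcases le_total ‖w‖ ‖z‖ with h | h <;> nlinarith

lemma floor_sector {x y : ℝ} (h : ⌊x * 3 / Real.pi⌋ = ⌊y * 3 / Real.pi⌋) :
    |x - y| < Real.pi / 3 := by
  have h := Int.abs_sub_lt_one_of_floor_eq_floor h
  have hp := Real.pi_pos
  have : x * 3 / Real.pi - y * 3 / Real.pi = (x - y) * (3 / Real.pi) := by ring
  rw [this, abs_mul, abs_of_pos (by positivity : (0:ℝ) < 3 / Real.pi)] at h
  rw [lt_div_iff₀ (by norm_num)]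
  have h2 : |x - y| * (3 / Real.pi) * Real.pi < 1 * Real.pi := by gcongr
  have h3 : |x - y| * (3 / Real.pi) * Real.pi = |x - y| * 3 := by field_simp
  linarith

lemma no_five_sector (s : Finset ℂ) (hs : 5 ≤ s.card) (h0 : ∀ z ∈ s, z ≠ 0)
    (h : ∀ z ∈ s, ∀ w ∈ s, z ≠ w → ‖z‖ ≤ ‖z - w‖)
    (t : Finset ℤ) (ht : t.card ≤ 4) (ε : ℝ) (hε : |ε| = 1)
    (hm : ∀ z ∈ s, ⌊(ε * z.arg) * 3 / Real.pi⌋ ∈ t) : False := by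
  obtain ⟨z, hz, w, hw, hne, heq⟩ := Finset.exists_ne_map_eq_of_card_lt_of_maps_to
    (s := s) (t := t) (by omega) (f := fun z : ℂ => ⌊(ε * z.arg) * 3 / Real.pi⌋) hm
  have := floor_sector heq
  rw [← mul_sub, abs_mul, hε, one_mul] at this
  refine angle_lt_aux z w (h0 z hz) (h0 w hw) (h z hz w hw hne) ?_ this
  rw [norm_sub_rev]; exact h w hw z hz hne.symm

lemma no_six (s : Finset ℂ) (hs : 6 ≤ s.card) (h0 : ∀ z ∈ s, z ≠ 0)
    (h : ∀ z ∈ s, ∀ w ∈ s, z ≠ w → ‖z‖ ≤ ‖z - w‖)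
    (tie : ∀ z ∈ s, ∀ w ∈ s, z ≠ w → ‖z‖ = ‖z - w‖ → 0 ≤ w.im) : False := by
  have hp := Real.pi_pos
  by_cases him : ∀ z ∈ s, 0 ≤ z.im
  · refine no_five_sector s (by omega) h0 h (Finset.Icc 0 3) (by simp) 1 (by simp) ?_
    intro z hz
    have h1 := Complex.arg_nonneg_iff.2 (him z hz)
    have h2 := Complex.arg_le_pi z
    rw [Finset.mem_Icc]
    constructor
    · apply Int.floor_nonneg.2; positivity
    · apply Int.lt_add_one_iff.1
      rw [Int.floor_lt, div_lt_iff₀ hp]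
      push_cast; linarith
  · push Not at him
    obtain ⟨u, hu, hneg⟩ := him
    have hu0 := h0 u hu
    have hun : 0 < ‖u‖ := norm_pos_iff.2 hu0
    have inj : Function.Injective (fun z : ℂ => z / u) := fun a b hab => by
      simpa [div_left_inj' hu0] using hab
    refine no_five_sector ((s.erase u).image (fun z => z / u)) ?_ ?_ ?_
      ({2, 1, -2, -3} : Finset ℤ) (by decide) (-1) (by simp) ?_
    · rw [Finset.card_image_of_injective _ inj, Finset.card_erase_of_mem hu]; omega
    · intro z hz
      simp only [Finset.mem_image, Finset.mem_erase] at hz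
      obtain ⟨a, ⟨_, ha⟩, rfl⟩ := hz
      exact div_ne_zero (h0 a ha) hu0
    · intro z hz w hw hne
      simp only [Finset.mem_image, Finset.mem_erase] at hz hw
      obtain ⟨a, ⟨_, ha⟩, rfl⟩ := hz
      obtain ⟨b, ⟨_, hb⟩, rfl⟩ := hw
      rw [← sub_div, norm_div, norm_div]
      gcongr
      exact h a ha b hb (fun e => hne (by rw [e]))
    · intro z hz
      simp only [Finset.mem_image, Finset.mem_erase] at hz
      obtain ⟨a, ⟨hau, ha⟩, rfl⟩ := hz
      have key : Real.pi / 3 < |(a / u).arg| := by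
        by_contra hcon
        push Not at hcon
        have e : ‖1 - a / u‖ = ‖u - a‖ / ‖u‖ := by
          rw [← norm_div, sub_div, div_self hu0]
        refine angle_le_aux 1 (a / u) one_ne_zero (div_ne_zero (h0 a ha) hu0) ?_ ?_ ?_
        · rw [e, norm_one, one_le_div hun]; exact h u hu a ha hau.symm
        · rw [e, norm_div]
          gcongr
          have h3 := h a ha u hu hau
          rw [norm_sub_rev] at h3
          refine lt_of_le_of_ne h3 fun h4 => ?_
          rw [norm_sub_rev] at h4
          exact absurd (tie a ha u hu hau h4) (not_le.2 hneg)
        · simpa using hcon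
      have h1 := Complex.neg_pi_lt_arg (a / u)
      have h2 := Complex.arg_le_pi (a / u)
      generalize (a / u).arg = θ at *
      have fl : ∀ n : ℤ, n * Real.pi ≤ -1 * θ * 3 → -1 * θ * 3 < (n + 1) * Real.pi →
          ⌊-1 * θ * 3 / Real.pi⌋ = n := by
        intro n ha hb
        rw [Int.floor_eq_iff]
        exact ⟨by rwa [le_div_iff₀ hp], by rwa [div_lt_iff₀ hp]⟩
      rcases lt_abs.1 key with k | k
      · by_cases c : 3 * θ ≤ 2 * Real.pi
        · rw [fl (-2) (by push_cast; linarith) (by push_cast; linarith)]; decide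
        · push Not at c
          rw [fl (-3) (by push_cast; linarith) (by push_cast; linarith)]; decide
      · by_cases c : 3 * θ ≤ -(2 * Real.pi)
        · rw [fl (2) (by push_cast; linarith) (by push_cast; linarith)]; decide
        · push Not at c
          rw [fl (1) (by push_cast; linarith) (by push_cast; linarith)]; decide

open SimpleGraph in
lemma tree_swap {V : Type*} [Finite V] (T : SimpleGraph V) (hT : T.IsTree) {v a x y : V}
    (hva : T.Adj v a) (hxy : x ≠ y)
    (hr : (T.deleteEdges {s(v, a)} ⊔ edge x y).Reachable v a) :
    (T.deleteEdges {s(v, a)} ⊔ edge x y).IsTree ∧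
    ∀ w : Sym2 V → ℝ,
      ∑ e ∈ (Set.toFinite (T.deleteEdges {s(v, a)} ⊔ edge x y).edgeSet).toFinset, w e =
      ∑ e ∈ (Set.toFinite T.edgeSet).toFinset, w e - w s(v, a) + w s(x, y) := by
  classical
  set T' := T.deleteEdges {s(v, a)} ⊔ edge x y with hT'
  have hbr : ¬ (T.deleteEdges {s(v, a)}).Reachable v a :=
    isBridge_iff.1 (isAcyclic_iff_forall_adj_isBridge.1 hT.isAcyclic hva)
  have hnew : s(x, y) ∉ T.edgeSet \ {s(v, a)} := by
    intro hmem
    apply hbr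
    rw [← edgeSet_deleteEdges, mem_edgeSet] at hmem
    have : T' = T.deleteEdges {s(v, a)} := by
      rw [hT', sup_eq_left]
      intro p q hpq
      rw [edge_adj] at hpq
      rcases hpq.1 with ⟨rfl, rfl⟩ | ⟨rfl, rfl⟩
      · exact hmem
      · exact hmem.symm
    rwa [this] at hr
  have hedge : (edge x y).edgeSet = {s(x, y)} := by
    rw [edgeSet_edge, sdiff_eq_left, Set.disjoint_singleton_left]
    simpa using hxy
  have hset : T'.edgeSet = insert s(x, y) (T.edgeSet \ {s(v, a)}) := by
    rw [hT', edgeSet_sup, edgeSet_deleteEdges, hedge, Set.union_singleton]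
  have hfin : (Set.toFinite T'.edgeSet).toFinset =
      insert s(x, y) ((Set.toFinite T.edgeSet).toFinset.erase s(v, a)) := by
    ext e; simp [hset, and_comm]
  have hn : s(x, y) ∉ (Set.toFinite T.edgeSet).toFinset.erase s(v, a) := by
    intro hm; apply hnew; simpa [and_comm] using hm
  have hm : s(v, a) ∈ (Set.toFinite T.edgeSet).toFinset := by simpa using hva
  have hsum : ∀ w : Sym2 V → ℝ, ∑ e ∈ (Set.toFinite T'.edgeSet).toFinset, w e =
      ∑ e ∈ (Set.toFinite T.edgeSet).toFinset, w e - w s(v, a) + w s(x, y) := by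
    intro w
    rw [hfin, Finset.sum_insert hn, ← Finset.add_sum_erase _ w hm]; ring
  refine ⟨?_, hsum⟩
  rw [isTree_iff_connected_and_card]
  constructor
  · have := hT.connected.nonempty
    refine ⟨fun p q => ?_⟩
    obtain ⟨W⟩ := hT.connected.preconnected p q
    induction W with
    | nil => rfl
    | @cons p q r hpq _ ih =>
      refine Reachable.trans ?_ ih
      by_cases he : s(p, q) = s(v, a)
      · rcases Sym2.eq_iff.1 he with ⟨rfl, rfl⟩ | ⟨rfl, rfl⟩
        · exact hr
        · exact hr.symm
      · apply Adj.reachable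
        left
        simp [deleteEdges_adj, hpq, he]
  · have h1 := (isTree_iff_connected_and_card.1 hT).2
    rw [← h1, Nat.card_coe_set_eq, Nat.card_coe_set_eq, hset, Set.ncard_insert_of_notMem hnew,
      Set.ncard_sdiff_singleton_add_one (by simpa using hva)]

open SimpleGraph in
lemma exists_lex_min_tree {V : Type*} [Finite V] [Nonempty V] (w φ : Sym2 V → ℝ) :
    ∃ T : SimpleGraph V, T.IsTree ∧ ∀ G : SimpleGraph V, G.IsTree →
      (∑ e ∈ (Set.toFinite T.edgeSet).toFinset, w e <
        ∑ e ∈ (Set.toFinite G.edgeSet).toFinset, w e) ∨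
      (∑ e ∈ (Set.toFinite T.edgeSet).toFinset, w e =
        ∑ e ∈ (Set.toFinite G.edgeSet).toFinset, w e ∧
       ∑ e ∈ (Set.toFinite T.edgeSet).toFinset, φ e ≤
        ∑ e ∈ (Set.toFinite G.edgeSet).toFinset, φ e) := by
  obtain ⟨T0, -, hT0⟩ := (connected_top (V := V)).exists_isTree_le
  obtain ⟨T, hT, hmin⟩ := Set.exists_min_image {T : SimpleGraph V | T.IsTree}
    (fun T => (toLex (∑ e ∈ (Set.toFinite T.edgeSet).toFinset, w e,
      ∑ e ∈ (Set.toFinite T.edgeSet).toFinset, φ e) : ℝ ×ₗ ℝ)) (Set.toFinite _) ⟨T0, hT0⟩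
  refine ⟨T, hT, fun G hG => ?_⟩
  have := hmin G hG
  simpa [Prod.Lex.toLex_le_toLex] using this

open SimpleGraph in
/-- Cut argument: a tree edge can be exchanged for some edge of any connected graph. -/
lemma exists_swap_edge {V : Type*} [Finite V] (T H : SimpleGraph V) (hT : T.IsTree)
    (hH : H.Connected) {v a : V} (hva : T.Adj v a) :
    ∃ x y, H.Adj x y ∧ (T.deleteEdges {s(v, a)} ⊔ edge x y).Reachable v a := by
  have hbr : ¬ (T.deleteEdges {s(v, a)}).Reachable v a :=
    isBridge_iff.1 (isAcyclic_iff_forall_adj_isBridge.1 hT.isAcyclic hva)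
  have hor : ∀ z, (T.deleteEdges {s(v, a)}).Reachable v z ∨
      (T.deleteEdges {s(v, a)}).Reachable a z := by
    intro z
    obtain ⟨W⟩ := hT.connected.preconnected z v
    induction W with
    | nil => left; rfl
    | @cons p q r hpq _ ih =>
      by_cases he : s(p, q) = s(r, a)
      · rcases Sym2.eq_iff.1 he with ⟨rfl, rfl⟩ | ⟨rfl, rfl⟩
        · left; rfl
        · right; rfl
      · have hadj : (T.deleteEdges {s(r, a)}).Adj q p := by
          rw [deleteEdges_adj]; exact ⟨hpq.symm, by rwa [Set.mem_singleton_iff, Sym2.eq_swap]⟩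
        exact (ih hva hbr).imp (·.trans hadj.reachable) (·.trans hadj.reachable)
  obtain ⟨W⟩ := hH.preconnected v a
  obtain ⟨d, hd, h1, h2⟩ := W.exists_boundary_dart
    {z | (T.deleteEdges {s(v, a)}).Reachable v z} (Reachable.refl _) hbr
  refine ⟨d.fst, d.snd, d.adj, ?_⟩
  have h3 : (T.deleteEdges {s(v, a)}).Reachable a d.snd := (hor _).resolve_left h2
  have hle : T.deleteEdges {s(v, a)} ≤ T.deleteEdges {s(v, a)} ⊔ edge d.fst d.snd := le_sup_left
  refine (Reachable.mono hle h1).trans (Reachable.trans (Adj.reachable ?_) (h3.mono hle).symm)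
  right
  rw [edge_adj]
  exact ⟨Or.inl ⟨rfl, rfl⟩, d.adj.ne⟩

lemma mst_facts (Y : Finset Pt) (hY : Y.Nonempty) :
    ∃ T : SimpleGraph ↥Y, T.IsTree ∧
      (∀ G : SimpleGraph ↥Y, G.IsTree → totalLen Y T ≤ totalLen Y G) ∧
      (∀ v : ↥Y, (T.neighborSet v).ncard ≤ 5) ∧
      ∀ r : ℝ, 0 ≤ r → ∀ H : SimpleGraph ↥Y, H.Connected →
        (∀ x y, H.Adj x y → dist (x : Pt) (y : Pt) ≤ r) → bneck Y T ≤ r := by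
  have : Nonempty ↥Y := hY.to_subtype
  let φ : Sym2 ↥Y → ℝ :=
    Sym2.lift ⟨fun a b => (a : Pt) 1 + (b : Pt) 1, fun _ _ => add_comm _ _⟩
  have hφ : ∀ a b : ↥Y, φ s(a, b) = (a : Pt) 1 + (b : Pt) 1 := fun _ _ => rfl
  have hw : ∀ a b : ↥Y, elen Y s(a, b) = dist (a : Pt) (b : Pt) := fun _ _ => rfl
  obtain ⟨T, hT, hmin⟩ := exists_lex_min_tree (elen Y) φ
  have swap : ∀ v a x y : ↥Y, T.Adj v a → x ≠ y →
      (T.deleteEdges {s(v, a)} ⊔ SimpleGraph.edge x y).Reachable v a →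
      dist (v : Pt) (a : Pt) < dist (x : Pt) (y : Pt) ∨
      (dist (v : Pt) (a : Pt) = dist (x : Pt) (y : Pt) ∧
        (v : Pt) 1 + (a : Pt) 1 ≤ (x : Pt) 1 + (y : Pt) 1) := by
    intro v a x y hva hxy hr
    obtain ⟨h1, h2⟩ := tree_swap T hT hva hxy hr
    have h3 := hmin _ h1
    rw [h2, h2, hφ, hφ, hw, hw] at h3
    rcases h3 with h3 | ⟨h3, h4⟩
    · left; linarith
    · right; exact ⟨by linarith, by linarith⟩
  refine ⟨T, hT, ?_, ?_, ?_⟩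
  · intro G hG
    rcases hmin G hG with h | h
    · exact h.le
    · exact h.1.le
  · intro v
    by_contra hcon
    push Not at hcon
    -- local exchange at `v`
    have loc : ∀ a b : ↥Y, T.Adj v a → T.Adj v b → a ≠ b →
        dist (v : Pt) (a : Pt) < dist (a : Pt) (b : Pt) ∨
        (dist (v : Pt) (a : Pt) = dist (a : Pt) (b : Pt) ∧ (v : Pt) 1 ≤ (b : Pt) 1) := by
      intro a b ha hb hab
      have := swap v a a b ha hab ?_
      · rcases this with h | ⟨h, h'⟩
        · exact Or.inl h
        · exact Or.inr ⟨h, by linarith⟩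
      · have h1 : (T.deleteEdges {s(v, a)} ⊔ SimpleGraph.edge a b).Adj v b := by
          left
          rw [SimpleGraph.deleteEdges_adj]
          refine ⟨hb, ?_⟩
          rw [Set.mem_singleton_iff, Sym2.eq_iff]
          rintro (⟨_, h⟩ | ⟨h, _⟩)
          · exact hab h.symm
          · exact ha.ne h
        have h2 : (T.deleteEdges {s(v, a)} ⊔ SimpleGraph.edge a b).Adj b a := by
          right
          rw [SimpleGraph.edge_adj]
          exact ⟨Or.inr ⟨rfl, rfl⟩, hab.symm⟩
        exact h1.reachable.trans h2.reachable
    let f : ↥Y → ℂ := fun a => ⟨(a : Pt) 0 - (v : Pt) 0, (a : Pt) 1 - (v : Pt) 1⟩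
    have hfd : ∀ a b : ↥Y, ‖f a - f b‖ = dist (a : Pt) (b : Pt) := by
      intro a b
      rw [EuclideanSpace.dist_eq, Fin.sum_univ_two, Complex.norm_eq_sqrt_sq_add_sq,
        Real.dist_eq, Real.dist_eq, sq_abs, sq_abs]
      simp [f]
    have hfv : f v = 0 := by simp [f, Complex.ext_iff]
    have hfn : ∀ a : ↥Y, ‖f a‖ = dist (v : Pt) (a : Pt) := by
      intro a
      rw [dist_comm, ← hfd, hfv, sub_zero]
    have inj : Function.Injective f := by
      intro a b hab
      have := hfd a b
      rw [hab, sub_self, norm_zero] at this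
      exact Subtype.ext (dist_eq_zero.1 this.symm)
    refine no_six ((Set.toFinite (T.neighborSet v)).toFinset.image f) ?_ ?_ ?_ ?_
    · rw [Finset.card_image_of_injective _ inj, ← Set.ncard_eq_toFinset_card _ _]
      exact hcon
    · intro z hz
      simp only [Finset.mem_image, Set.Finite.mem_toFinset, SimpleGraph.mem_neighborSet] at hz
      obtain ⟨a, ha, rfl⟩ := hz
      intro h0
      exact ha.ne (inj (hfv.trans h0.symm))
    · intro z hz w hw hne
      simp only [Finset.mem_image, Set.Finite.mem_toFinset, SimpleGraph.mem_neighborSet] at hz hw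
      obtain ⟨a, ha, rfl⟩ := hz
      obtain ⟨b, hb, rfl⟩ := hw
      rw [hfn, hfd]
      rcases loc a b ha hb (fun e => hne (by rw [e])) with h | h
      · exact h.le
      · exact h.1.le
    · intro z hz w hw hne
      simp only [Finset.mem_image, Set.Finite.mem_toFinset, SimpleGraph.mem_neighborSet] at hz hw
      obtain ⟨a, ha, rfl⟩ := hz
      obtain ⟨b, hb, rfl⟩ := hw
      rw [hfn, hfd]
      intro heq
      rcases loc a b ha hb (fun e => hne (by rw [e])) with h | h
      · exact absurd heq h.ne
      · have := h.2
        simp only [f]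
        linarith
  · intro r hr H hH hHr
    unfold bneck
    refine Real.iSup_le (fun e => Real.iSup_le (fun he => ?_) hr) hr
    induction e using Sym2.ind with
    | _ v a =>
      rw [SimpleGraph.mem_edgeSet] at he
      rw [hw]
      obtain ⟨x, y, hxy, hreach⟩ := exists_swap_edge T H hT hH he
      have h1 := hHr x y hxy
      rcases swap v a x y he hxy.ne hreach with h | h
      · linarith
      · linarith [h.1]

lemma dist_le_bneck (Y : Finset Pt) (G : SimpleGraph ↥Y) {a b : ↥Y} (h : G.Adj a b) :
    dist (a : Pt) (b : Pt) ≤ bneck Y G := by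
  have h1 : elen Y s(a, b) ≤ ⨆ (_ : s(a, b) ∈ G.edgeSet), elen Y s(a, b) := by
    rw [ciSup_pos (by simpa using h)]
  refine le_trans h1 (le_ciSup (f := fun e => ⨆ (_ : e ∈ G.edgeSet), elen Y e) ?_ s(a, b))
  exact (Set.finite_range _).bddAbove

/-- Positions of the index set: terminals, then Steiner points. -/
def posn (X : Finset Pt) (k : ℕ) (f : Fin k → Pt) : ↥X ⊕ Fin k → Pt :=
  Sum.elim (fun x => (x : Pt)) f

/-- Longest edge of a graph on the index set. -/
def cost (X : Finset Pt) (k : ℕ) (G : SimpleGraph (↥X ⊕ Fin k)) (f : Fin k → Pt) : ℝ :=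
  ⨆ e : {e : (↥X ⊕ Fin k) × (↥X ⊕ Fin k) // G.Adj e.1 e.2},
    dist (posn X k f e.1.1) (posn X k f e.1.2)

lemma cost_nonneg (X : Finset Pt) (k : ℕ) (G : SimpleGraph (↥X ⊕ Fin k)) (f : Fin k → Pt) :
    0 ≤ cost X k G f := Real.iSup_nonneg fun _ => dist_nonneg

lemma dist_le_cost (X : Finset Pt) (k : ℕ) (G : SimpleGraph (↥X ⊕ Fin k)) (f : Fin k → Pt)
    {i j : ↥X ⊕ Fin k} (h : G.Adj i j) : dist (posn X k f i) (posn X k f j) ≤ cost X k G f :=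
  le_ciSup (f := fun e : {e : (↥X ⊕ Fin k) × (↥X ⊕ Fin k) // G.Adj e.1 e.2} =>
    dist (posn X k f e.1.1) (posn X k f e.1.2)) (Set.finite_range _).bddAbove ⟨(i, j), h⟩

lemma exists_min_cost (X : Finset Pt) (hX : X.Nonempty) (k : ℕ) (G : SimpleGraph (↥X ⊕ Fin k))
    (hG : G.Connected) : ∃ f, ∀ f', cost X k G f ≤ cost X k G f' := by
  obtain ⟨x0, hx0⟩ := hX
  set C := cost X k G (fun _ => x0) with hC
  have hC0 : 0 ≤ C := cost_nonneg _ _ _ _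
  have hcont : ∀ i, Continuous fun f => posn X k f i := by
    intro i
    rcases i with x | j
    · exact continuous_const
    · exact continuous_apply j
  have bound : ∀ f, cost X k G f ≤ C → ∀ i j, ∀ W : G.Walk i j,
      dist (posn X k f i) (posn X k f j) ≤ W.length * C := by
    intro f hf i j W
    induction W with
    | nil => simp
    | @cons p q r hpq W ih =>
      have h1 := dist_le_cost X k G f hpq
      have h2 := dist_triangle (posn X k f p) (posn X k f q) (posn X k f r)
      rw [SimpleGraph.Walk.length_cons]
      push_cast
      linarith
  have hW : ∀ j : Fin k, Nonempty (G.Walk (Sum.inr j) (Sum.inl ⟨x0, hx0⟩)) :=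
    fun j => hG.preconnected _ _
  let L : Set ((Fin k → Pt) × ℝ) :=
    ((Set.univ.pi fun j => Metric.closedBall x0 ((hW j).some.length * C)) ×ˢ Set.Icc 0 C) ∩
    ⋂ e : {e : (↥X ⊕ Fin k) × (↥X ⊕ Fin k) // G.Adj e.1 e.2},
      {q | dist (posn X k q.1 e.1.1) (posn X k q.1 e.1.2) ≤ q.2}
  have hL : IsCompact L := by
    refine IsCompact.inter_right ((isCompact_univ_pi fun j =>
      isCompact_closedBall _ _).prod isCompact_Icc) (isClosed_iInter fun e => ?_)
    exact isClosed_le (((hcont _).comp continuous_fst).dist ((hcont _).comp continuous_fst))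
      continuous_snd
  have hmem : ∀ f, cost X k G f ≤ C → (f, cost X k G f) ∈ L := by
    intro f hf
    refine ⟨⟨?_, cost_nonneg _ _ _ _, hf⟩, ?_⟩
    · intro j _
      exact bound f hf _ _ (hW j).some
    · rw [Set.mem_iInter]
      intro e
      exact dist_le_cost X k G f e.2
  obtain ⟨q, hq, hmin⟩ := hL.exists_isMinOn ⟨_, hmem _ hC.symm.le⟩ continuous_snd.continuousOn
  have hq2 : cost X k G q.1 ≤ q.2 := by
    refine Real.iSup_le (fun e => ?_) hq.1.2.1
    exact Set.mem_iInter.1 hq.2 e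
  refine ⟨q.1, fun f' => ?_⟩
  rcases le_total (cost X k G f') C with h | h
  · exact hq2.trans (hmin (hmem f' h))
  · exact hq2.trans (hq.1.2.2.trans h)

lemma exists_global_min (X : Finset Pt) (hX : X.Nonempty) (k : ℕ) :
    ∃ (G : SimpleGraph (↥X ⊕ Fin k)) (f : Fin k → Pt), G.Connected ∧
      ∀ G' f', G'.Connected → cost X k G f ≤ cost X k G' f' := by
  have : Nonempty (↥X ⊕ Fin k) := ⟨Sum.inl ⟨_, hX.choose_spec⟩⟩
  choose! F hF using exists_min_cost X hX k
  obtain ⟨G, hG, hmin⟩ := Set.exists_min_image {G : SimpleGraph (↥X ⊕ Fin k) | G.Connected}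
    (fun G => cost X k G (F G)) (Set.toFinite _) ⟨⊤, SimpleGraph.connected_top⟩
  exact ⟨G, F G, hG, fun G' f' hG' => (hmin G' hG').trans (hF G' hG' f')⟩

lemma exists_index_graph (X : Finset Pt) (hX : X.Nonempty) (k : ℕ) (hk : 0 < k)
    (S : Finset Pt) (hS : S.card ≤ k) (T : SimpleGraph ↥(X ∪ S)) (hT : T.IsTree) :
    ∃ (G : SimpleGraph (↥X ⊕ Fin k)) (f : Fin k → Pt), G.Connected ∧
      cost X k G f ≤ bneck (X ∪ S) T := by
  have hf : ∃ f : Fin k → Pt, (∀ j, f j ∈ X ∪ S) ∧ ∀ s ∈ S, ∃ j, f j = s := by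
    obtain ⟨x0, hx0⟩ := hX
    refine ⟨fun j => if h : (j : ℕ) < S.card then (S.equivFin.symm ⟨j, h⟩ : Pt) else x0, ?_, ?_⟩
    · intro j
      dsimp only
      split_ifs with h
      · exact Finset.mem_union_right _ (S.equivFin.symm ⟨j, h⟩).2
      · exact Finset.mem_union_left _ hx0
    · intro s hs
      refine ⟨⟨S.equivFin ⟨s, hs⟩, (S.equivFin ⟨s, hs⟩).2.trans_le hS⟩, ?_⟩
      simp
  obtain ⟨f, hf1, hf2⟩ := hf
  have hp : ∀ i, posn X k f i ∈ X ∪ S := by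
    rintro (x | j)
    · exact Finset.mem_union_left _ x.2
    · exact hf1 j
  let p : ↥X ⊕ Fin k → ↥(X ∪ S) := fun i => ⟨posn X k f i, hp i⟩
  have hsurj : Function.Surjective p := by
    rintro ⟨y, hy⟩
    rcases Finset.mem_union.1 hy with h | h
    · exact ⟨Sum.inl ⟨y, h⟩, rfl⟩
    · obtain ⟨j, hj⟩ := hf2 y h
      exact ⟨Sum.inr j, Subtype.ext hj⟩
  let G : SimpleGraph (↥X ⊕ Fin k) :=
    { Adj := fun i j => i ≠ j ∧ (p i = p j ∨ T.Adj (p i) (p j))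
      symm := ⟨fun i j h => ⟨h.1.symm, h.2.imp Eq.symm fun h => h.symm⟩⟩
      loopless := ⟨fun i h => h.1 rfl⟩ }
  have hb0 : 0 ≤ bneck (X ∪ S) T := by
    refine Real.iSup_nonneg fun e => Real.iSup_nonneg fun _ => ?_
    induction e using Sym2.ind with
    | _ a b => exact dist_nonneg (x := (a : Pt)) (y := (b : Pt))
  refine ⟨G, f, ?_, ?_⟩
  · have : Nonempty (↥X ⊕ Fin k) := ⟨Sum.inl ⟨_, hX.choose_spec⟩⟩
    refine ⟨fun i j => ?_⟩
    have key : ∀ a b : ↥(X ∪ S), T.Walk a b → ∀ i j, p i = a → p j = b → G.Reachable i j := by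
      intro a b W
      induction W with
      | nil =>
        intro i j hi hj
        by_cases h : i = j
        · rw [h]
        · exact SimpleGraph.Adj.reachable ⟨h, Or.inl (hi.trans hj.symm)⟩
      | @cons a b c hab W ih =>
        intro i j hi hj
        obtain ⟨m, hm⟩ := hsurj b
        refine SimpleGraph.Reachable.trans (SimpleGraph.Adj.reachable (v := m) ⟨?_, Or.inr ?_⟩)
          (ih m j hm hj)
        · rintro rfl
          exact hab.ne (hi.symm.trans hm)
        · rw [hi, hm]; exact hab
    obtain ⟨W⟩ := hT.connected.preconnected (p i) (p j)
    exact key _ _ W i j rfl rfl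
  · refine Real.iSup_le (fun e => ?_) hb0
    rcases e.2.2 with h | h
    · have : posn X k f e.1.1 = posn X k f e.1.2 := congrArg Subtype.val h
      rw [this, dist_self]; exact hb0
    · exact dist_le_bneck (X ∪ S) T (a := p e.1.1) (b := p e.1.2) h

/-- there is a k-bottleneck Steiner minimum tree that is an MST on its full
node set and has maximum degree at most 5. -/
theorem exists_kBST_mst_maxDegree_le_five (X : Finset Pt) (hX : X.Nonempty)
    (k : ℕ) (hk : 0 < k) :
    ∃ (S : Finset Pt) (T : SimpleGraph ↥(X ∪ S)), S.card ≤ k ∧ T.IsTree ∧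
      (∀ S₂ : Finset Pt, S₂.card ≤ k → ∀ T₂ : SimpleGraph ↥(X ∪ S₂), T₂.IsTree →
        bneck (X ∪ S) T ≤ bneck (X ∪ S₂) T₂) ∧
      (∀ G : SimpleGraph ↥(X ∪ S), G.IsTree →
        totalLen (X ∪ S) T ≤ totalLen (X ∪ S) G) ∧
      ∀ v : ↥(X ∪ S), (T.neighborSet v).ncard ≤ 5 := by
  obtain ⟨G, f, hG, hmin⟩ := exists_global_min X hX k
  obtain ⟨T, hT, hlen, hdeg, hbn⟩ := mst_facts (X ∪ Finset.univ.image f)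
    (hX.mono Finset.subset_union_left)
  refine ⟨Finset.univ.image f, T, ?_, hT, ?_, hlen, hdeg⟩
  · exact Finset.card_image_le.trans (by simp)
  · intro S₂ hS₂ T₂ hT₂
    obtain ⟨G₂, f₂, hG₂, hc⟩ := exists_index_graph X hX k hk S₂ hS₂ T₂ hT₂
    refine le_trans ?_ ((hmin G₂ f₂ hG₂).trans hc)
    have hp : ∀ i, posn X k f i ∈ X ∪ Finset.univ.image f := by
      rintro (x | j)
      · exact Finset.mem_union_left _ x.2
      · exact Finset.mem_union_right _ (Finset.mem_image_of_mem f (Finset.mem_univ j))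
    let H : SimpleGraph ↥(X ∪ Finset.univ.image f) :=
      { Adj := fun a b => a ≠ b ∧ dist (a : Pt) (b : Pt) ≤ cost X k G f
        symm := ⟨fun a b h => ⟨h.1.symm, by rw [dist_comm]; exact h.2⟩⟩
        loopless := ⟨fun a h => h.1 rfl⟩ }
    refine hbn _ (cost_nonneg _ _ _ _) H ?_ fun x y h => h.2
    have hreach : ∀ i j, G.Walk i j → H.Reachable ⟨posn X k f i, hp i⟩ ⟨posn X k f j, hp j⟩ := by
      intro i j W
      induction W with
      | nil => rfl
      | @cons a b c hab W ih =>
        refine SimpleGraph.Reachable.trans ?_ ih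
        by_cases h : posn X k f a = posn X k f b
        · simp only [h]; rfl
        · exact SimpleGraph.Adj.reachable
            ⟨fun e => h (congrArg Subtype.val e), dist_le_cost X k G f hab⟩
    have hsurj : ∀ y : ↥(X ∪ Finset.univ.image f), ∃ i, (⟨posn X k f i, hp i⟩ : ↥(_ : Finset Pt)) = y := by
      rintro ⟨y, hy⟩
      rcases Finset.mem_union.1 hy with h | h
      · exact ⟨Sum.inl ⟨y, h⟩, rfl⟩
      · obtain ⟨j, -, hj⟩ := Finset.mem_image.1 h
        exact ⟨Sum.inr j, Subtype.ext hj⟩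
    have := hT.connected.nonempty
    refine ⟨fun a b => ?_⟩
    obtain ⟨i, rfl⟩ := hsurj a
    obtain ⟨j, rfl⟩ := hsurj b
    obtain ⟨W⟩ := hG.preconnected i j
    exact hreach i j W
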